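/- Let r be a power of p and m = (m_j)_{j≥0} an integer sequence with m_0 = 1 and m_j ≥ 2 for all j ≥ 1. If moreover m_j ≥ 3 for all sufficiently large j, then t(ξ(r,m)) ≤ limsup_{j→∞} (2 m_j + 2 m_j m_{j+1}). -/

import Mathlib

open Polynomial Filter Set
open scoped Classical

noncomputable section

namespace OotoT

variable (Fq : Type) [Field Fq]

/-- We model the field `F_q((T⁻¹))` of Laurent series in `T⁻¹` as `LaurentSeries Fq`,
whose canonical variable `u` plays the role of `T⁻¹`.  Thus `T` itself is `u⁻¹`. -/
def Tel : LaurentSeries Fq := (HahnSeries.single (1 : ℤ) (1 : Fq))⁻¹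

/-- The canonical ring embedding `F_q[T] → F_q((T⁻¹))`, sending `T ↦ u⁻¹`. -/
def ringHomT : Polynomial Fq →+* LaurentSeries Fq :=
  Polynomial.eval₂RingHom (HahnSeries.C : Fq →+* LaurentSeries Fq) (Tel Fq)

/-- The absolute value on `F_q((T⁻¹))`: `|0| = 0` and `|ξ| = q^{-N}` where
`ξ = Σ_{n ≥ N} a_n T^{-n}` with `a_N ≠ 0`; in our model `N` is the order of `ξ`
as a Hahn series in `u = T⁻¹`. -/
def absL (q : ℕ) (ξ : LaurentSeries Fq) : ℝ :=
  if ξ = 0 then 0 else (q : ℝ) ^ (-ξ.order)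

/-- Evaluation of a polynomial `P(X) ∈ (F_q[T])[X]` at `ξ ∈ F_q((T⁻¹))`. -/
def evalP (ξ : LaurentSeries Fq) (P : Polynomial (Polynomial Fq)) : LaurentSeries Fq :=
  Polynomial.eval₂ (ringHomT Fq) ξ P

/-- The height of `P(X) ∈ (F_q[T])[X]`: the maximum of the absolute values of its
coefficients.  A nonzero `c ∈ F_q[T]` has `|c| = q^{deg c}`, so for `P ≠ 0` the height
is `q` raised to the maximal degree of a (nonzero) coefficient of `P`. -/
def heightP (q : ℕ) (P : Polynomial (Polynomial Fq)) : ℝ :=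
  if P = 0 then 0 else (q : ℝ) ^ (P.support.sup fun i => (P.coeff i).natDegree)

/-- `w_n(ξ)`: the supremum (in the extended reals) of the real numbers `w` such that
`0 < |P(ξ)| ≤ H(P)^{-w}` for infinitely many `P(X) ∈ (F_q[T])[X]` of degree at most `n`. -/
def wn (q : ℕ) (n : ℕ) (ξ : LaurentSeries Fq) : EReal :=
  sSup ((fun w : ℝ => (w : EReal)) ''
    {w : ℝ | {P : Polynomial (Polynomial Fq) | P.natDegree ≤ n ∧
      0 < absL Fq q (evalP Fq ξ P) ∧
      absL Fq q (evalP Fq ξ P) ≤ heightP Fq q P ^ (-w)}.Infinite})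

/-- `w(ξ) = limsup_{n→∞} w_n(ξ)/n`. -/
def wB (q : ℕ) (ξ : LaurentSeries Fq) : EReal :=
  Filter.limsup (fun n : ℕ => wn Fq q n ξ / (n : EReal)) Filter.atTop

/-- `ξ` is an `A`-number if `w(ξ) = 0`. -/
def IsANumber (q : ℕ) (ξ : LaurentSeries Fq) : Prop := wB Fq q ξ = 0

/-- `ξ` is an `S`-number if `0 < w(ξ) < +∞`. -/
def IsSNumber (q : ℕ) (ξ : LaurentSeries Fq) : Prop := 0 < wB Fq q ξ ∧ wB Fq q ξ < ⊤

/-- `ξ` is a `T`-number if `w(ξ) = +∞` and `w_n(ξ) < +∞` for all `n ≥ 1`. -/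
def IsTNumber (q : ℕ) (ξ : LaurentSeries Fq) : Prop :=
  wB Fq q ξ = ⊤ ∧ ∀ n : ℕ, 1 ≤ n → wn Fq q n ξ < ⊤

/-- `ξ` is a `U`-number if `w(ξ) = +∞` and `w_n(ξ) = +∞` for some `n ≥ 1`. -/
def IsUNumber (q : ℕ) (ξ : LaurentSeries Fq) : Prop :=
  wB Fq q ξ = ⊤ ∧ ∃ n : ℕ, 1 ≤ n ∧ wn Fq q n ξ = ⊤

/-- The type `t(ξ) = limsup_{n→∞} (log w_n(ξ))/(log n)` of a `T`-number (as an
extended real; for a `T`-number each `w_n(ξ)` is a finite real, recovered by `toReal`). -/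
def typeT (q : ℕ) (ξ : LaurentSeries Fq) : EReal :=
  Filter.limsup
    (fun n : ℕ => ((Real.log (wn Fq q n ξ).toReal / Real.log n : ℝ) : EReal)) Filter.atTop

/-! ### The algebraic closure side -/

/-- The algebraic closure of `F_q((T⁻¹))`. -/
abbrev AC := AlgebraicClosure (LaurentSeries Fq)

/-- The canonical embedding of `F_q((T⁻¹))` into its algebraic closure. -/
def iota : LaurentSeries Fq →+* AC Fq := algebraMap _ _

/-- The embedding `F_q[T] → AC`. -/
def ringHomTC : Polynomial Fq →+* AC Fq := (iota Fq).comp (ringHomT Fq)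

/-- Evaluation of `P(X) ∈ (F_q[T])[X]` at an element of the algebraic closure. -/
def evalPC (α : AC Fq) (P : Polynomial (Polynomial Fq)) : AC Fq :=
  Polynomial.eval₂ (ringHomTC Fq) α P

/-- `P ∈ (F_q[T])[X]` is *the* minimal polynomial of `α`: it is non-constant, irreducible,
primitive, its leading coefficient is monic (in `T`), and `P(α) = 0`.  For `α` algebraic
over `F_q(T)` such a polynomial exists and is unique. -/
def IsMinPolyOf (α : AC Fq) (P : Polynomial (Polynomial Fq)) : Prop :=
  0 < P.natDegree ∧ Irreducible P ∧ P.IsPrimitive ∧ P.leadingCoeff.Monic ∧ evalPC Fq α P = 0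

/-- `α` is algebraic over `F_q(T)`. -/
def IsAlgT (α : AC Fq) : Prop := ∃ P, IsMinPolyOf Fq α P

/-- The degree of an algebraic `α`: the degree of its minimal polynomial. -/
def degT (α : AC Fq) : ℕ := if h : IsAlgT Fq α then h.choose.natDegree else 0

/-- The height of an algebraic `α`: the height of its minimal polynomial. -/
def heightT (q : ℕ) (α : AC Fq) : ℝ := if h : IsAlgT Fq α then heightP Fq q h.choose else 0

/-- The unique extension of the absolute value to the algebraic closure of `F_q((T⁻¹))`,
given by the standard formula `|x| = |N_{K(x)/K}(x)|^{1/[K(x):K]}`, i.e.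
`|x| = |c₀|^{1/d}` where `c₀` is the constant coefficient and `d` the degree of the
minimal polynomial of `x` over `K = F_q((T⁻¹))`. -/
def absC (q : ℕ) (x : AC Fq) : ℝ :=
  absL Fq q ((minpoly (LaurentSeries Fq) x).coeff 0) ^
    (((minpoly (LaurentSeries Fq) x).natDegree : ℝ)⁻¹)

/-- `w_n^*(ξ)`: the supremum (in the extended reals) of the real numbers `w` such that
`0 < |ξ - α| ≤ H(α)^{-w-1}` for infinitely many `α` algebraic over `F_q(T)` of degree
at most `n`. -/
def wnStar (q : ℕ) (n : ℕ) (ξ : LaurentSeries Fq) : EReal :=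
  sSup ((fun w : ℝ => (w : EReal)) ''
    {w : ℝ | {α : AC Fq | IsAlgT Fq α ∧ degT Fq α ≤ n ∧
      0 < absC Fq q (iota Fq ξ - α) ∧
      absC Fq q (iota Fq ξ - α) ≤ heightT Fq q α ^ (-w - 1)}.Infinite})

/-- `w^*(ξ) = limsup_{n→∞} w_n^*(ξ)/n`. -/
def wBStar (q : ℕ) (ξ : LaurentSeries Fq) : EReal :=
  Filter.limsup (fun n : ℕ => wnStar Fq q n ξ / (n : EReal)) Filter.atTop

/-- `ξ` is an `A*`-number if `w^*(ξ) = 0`. -/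
def IsAStarNumber (q : ℕ) (ξ : LaurentSeries Fq) : Prop := wBStar Fq q ξ = 0

/-- `ξ` is a `T*`-number if `w^*(ξ) = +∞` and `w_n^*(ξ) < +∞` for all `n ≥ 1`. -/
def IsTStarNumber (q : ℕ) (ξ : LaurentSeries Fq) : Prop :=
  wBStar Fq q ξ = ⊤ ∧ ∀ n : ℕ, 1 ≤ n → wnStar Fq q n ξ < ⊤

/-- The `*`-type `t^*(ξ) = limsup_{n→∞} (log w_n^*(ξ))/(log n)` of a `T*`-number. -/
def typeTStar (q : ℕ) (ξ : LaurentSeries Fq) : EReal :=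
  Filter.limsup
    (fun n : ℕ => ((Real.log (wnStar Fq q n ξ).toReal / Real.log n : ℝ) : EReal)) Filter.atTop

/-! ### The Laurent series `ξ(r, m)` -/

/-- `r_j = r^{m_0 m_1 ⋯ m_j}`. -/
def rr (r : ℕ) (m : ℕ → ℕ) (j : ℕ) : ℕ := r ^ (∏ i ∈ Finset.range (j + 1), m i)

/-- `α_j(r, m) = Σ_{n=1}^∞ T^{-r_j^n}`, i.e. the power series in `u = T⁻¹` whose
`k`-th coefficient is `1` exactly when `k = r_j^n` for some `n ≥ 1`. -/
def alphaJ (r : ℕ) (m : ℕ → ℕ) (j : ℕ) : LaurentSeries Fq :=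
  HahnSeries.ofPowerSeries ℤ Fq (PowerSeries.mk fun k =>
    if ∃ n : ℕ, 1 ≤ n ∧ k = rr r m j ^ n then 1 else 0)

/-- `ξ_a(r, m) = Σ_{j=0}^∞ a_j α_j(r, m)`, described coefficientwise: the coefficient of
`T^{-k}` is the (finite) sum over `j` of `a_j` times the coefficient of `T^{-k}` in
`α_j(r, m)`. -/
def xiA (r : ℕ) (m : ℕ → ℕ) (a : ℕ → ℕ) : LaurentSeries Fq :=
  HahnSeries.ofPowerSeries ℤ Fq (PowerSeries.mk fun k =>
    ∑ᶠ j : ℕ, (a j : Fq) * (if ∃ n : ℕ, 1 ≤ n ∧ k = rr r m j ^ n then 1 else 0))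

/-- `ξ(r, m) = Σ_{j=0}^∞ α_j(r, m)`. -/
def xi (r : ℕ) (m : ℕ → ℕ) : LaurentSeries Fq := xiA Fq r m fun _ => 1

/-! ### Algebraicity and algebraic dependence over `F_q(T)` for Laurent series -/

/-- `ξ ∈ F_q((T⁻¹))` is algebraic over `F_q(T)`. -/
def IsAlgLS (ξ : LaurentSeries Fq) : Prop :=
  ∃ P : Polynomial (Polynomial Fq), P ≠ 0 ∧ evalP Fq ξ P = 0

/-- Evaluation of a two-variable polynomial `F(X, Y) ∈ (F_q[T])[X, Y]` (coded as an
iterated polynomial ring, `T` innermost, then `X`, then `Y`) at `(ξ, η)`. -/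
def evalXY (ξ η : LaurentSeries Fq) (F : Polynomial (Polynomial (Polynomial Fq))) :
    LaurentSeries Fq :=
  Polynomial.eval₂ (Polynomial.eval₂RingHom (ringHomT Fq) ξ) η F

/-- `ξ` and `η` are algebraically dependent over `F_q(T)`. -/
def AlgDep (ξ η : LaurentSeries Fq) : Prop :=
  ∃ F : Polynomial (Polynomial (Polynomial Fq)), F ≠ 0 ∧ evalXY Fq ξ η F = 0

/-- `deg_X` of `F(X, Y) ∈ (F_q[T])[X, Y]` in our encoding. -/
def degX (F : Polynomial (Polynomial (Polynomial Fq))) : ℕ :=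
  F.support.sup fun i => (F.coeff i).natDegree

/-- `F(X, Y) ∈ (F_q[T])[X, Y]` is primitive (in `X` and `Y`): no non-unit of `F_q[T]`
divides all of its coefficients. -/
def IsPrimitiveXY (F : Polynomial (Polynomial (Polynomial Fq))) : Prop :=
  ∀ c : Polynomial Fq, (∀ i j : ℕ, c ∣ ((F.coeff i).coeff j)) → IsUnit c

end OotoT

open OotoT

namespace OotoT

open HahnSeries

section Valuation

variable {Fq : Type} [Field Fq]

lemma ringHomT_monomial (i : ℕ) (a : Fq) :
    ringHomT Fq (monomial i a) = single (-(i : ℤ)) a := by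
  have hinv : (single (1 : ℤ) (1 : Fq))⁻¹ = single (-1 : ℤ) (1 : Fq) := by
    refine inv_eq_of_mul_eq_one_right ?_
    simp [single_mul_single]
  simp [ringHomT, Tel, hinv, HahnSeries.C_apply, single_pow, single_mul_single]

lemma coeff_ringHomT (c : Fq[X]) (i : ℕ) : (ringHomT Fq c).coeff (-(i : ℤ)) = c.coeff i := by
  induction c using Polynomial.induction_on' with
  | add f g hf hg => simp [hf, hg]
  | monomial j a =>
    rw [ringHomT_monomial, Polynomial.coeff_monomial]
    by_cases h : j = i
    · simp [h]
    · rw [if_neg h, coeff_single_of_ne (by omega)]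

lemma addVal_ringHomT_le_zero {c : Fq[X]} (hc : c ≠ 0) : addVal ℤ Fq (ringHomT Fq c) ≤ 0 := by
  have h : (ringHomT Fq c).coeff (-(c.natDegree : ℤ)) ≠ 0 := by
    rw [coeff_ringHomT]; simpa using hc
  refine (addVal_le_of_coeff_ne_zero h).trans ?_
  exact_mod_cast (by omega : (-(c.natDegree : ℤ)) ≤ 0)

lemma neg_le_addVal_ringHomT {c : Fq[X]} {D : ℕ} (hc : c.natDegree ≤ D) :
    ((-(D : ℤ) : ℤ) : WithTop ℤ) ≤ addVal ℤ Fq (ringHomT Fq c) := by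
  rw [c.as_sum_range' (D + 1) (by omega), map_sum]
  refine AddValuation.map_le_sum _ fun i hi => ?_
  rw [ringHomT_monomial, addVal_apply]
  refine le_trans ?_ orderTop_single_le
  have := Finset.mem_range.mp hi
  exact_mod_cast (by omega : (-(D : ℤ)) ≤ -(i : ℤ))

lemma addVal_ofPowerSeries_nonneg (f : PowerSeries Fq) :
    0 ≤ addVal ℤ Fq (ofPowerSeries ℤ Fq f) := by
  by_contra! h
  rw [addVal_apply] at h
  obtain ⟨g, hg⟩ := WithTop.ne_top_iff_exists.1 h.ne_top
  refine coeff_orderTop_ne hg.symm ?_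
  rw [ofPowerSeries_apply]
  refine embDomain_of_notMem_range ?_
  rintro ⟨k, rfl⟩
  rw [← hg] at h
  exact absurd h (not_lt.2 (WithTop.coe_le_coe.2 (Int.natCast_nonneg k)))

lemma le_addVal_ofPowerSeries_X_pow_mul (B : ℕ) (f : PowerSeries Fq) :
    ((B : ℤ) : WithTop ℤ) ≤ addVal ℤ Fq (ofPowerSeries ℤ Fq (PowerSeries.X ^ B * f)) := by
  rw [map_mul, ofPowerSeries_X_pow, AddValuation.map_mul, addVal_apply, orderTop_single one_ne_zero]
  simpa using add_le_add (le_refl ((B : ℤ) : WithTop ℤ)) (addVal_ofPowerSeries_nonneg f)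

lemma neg_le_addVal_evalP {S : Fq[X][X]} {D : ℕ} (hS : ∀ i, (S.coeff i).natDegree ≤ D)
    (f : PowerSeries Fq) :
    ((-(D : ℤ) : ℤ) : WithTop ℤ) ≤ addVal ℤ Fq (evalP Fq (ofPowerSeries ℤ Fq f) S) := by
  rw [evalP, eval₂_eq_sum_range]
  refine AddValuation.map_le_sum _ fun i _ => ?_
  rw [← map_pow, AddValuation.map_mul]
  simpa using add_le_add (neg_le_addVal_ringHomT (hS i)) (addVal_ofPowerSeries_nonneg (f ^ i))

lemma le_addVal_evalP_sub {Q : Fq[X][X]} {D B : ℕ} (hQ : ∀ i, (Q.coeff i).natDegree ≤ D)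
    {f g : PowerSeries Fq} (hfg : PowerSeries.X ^ B ∣ f - g) :
    ((B - D : ℤ) : WithTop ℤ) ≤ addVal ℤ Fq
      (evalP Fq (ofPowerSeries ℤ Fq f) Q - evalP Fq (ofPowerSeries ℤ Fq g) Q) := by
  rw [evalP, evalP, eval₂_eq_sum_range, eval₂_eq_sum_range, ← Finset.sum_sub_distrib]
  refine AddValuation.map_le_sum _ fun i _ => ?_
  obtain ⟨k, hk⟩ := hfg.trans (sub_dvd_pow_sub_pow f g i)
  rw [← map_pow, ← map_pow, ← mul_sub, ← map_sub, hk, AddValuation.map_mul]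
  refine le_trans ?_ (add_le_add (neg_le_addVal_ringHomT (hQ i))
    (le_addVal_ofPowerSeries_X_pow_mul B k))
  exact_mod_cast (by omega : (B - D : ℤ) ≤ -D + B)

end Valuation

end OotoT

namespace OotoT

section AuxiliaryPolynomial

variable {F : Type} [Field F]

/-- The polynomial in two variables with prescribed coefficients in a rectangle. -/
def rectPoly (k l : ℕ) : (Fin k × Fin l → F) →ₗ[F] F[X][X] :=
  Fintype.linearCombination F fun x : Fin k × Fin l => monomial (x.1 : ℕ) (monomial (x.2 : ℕ) 1)

lemma coeff_coeff_rectPoly {k l : ℕ} (f : Fin k × Fin l → F) (x : Fin k × Fin l) :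
    ((rectPoly k l f).coeff x.1).coeff x.2 = f x := by
  rw [rectPoly, Fintype.linearCombination_apply, finsetSum_coeff, finsetSum_coeff,
    Finset.sum_eq_single x]
  · simp
  · intro y _ hy
    by_cases h1 : (y.1 : ℕ) = x.1
    · have h2 : (y.2 : ℕ) ≠ x.2 := fun h => hy (Prod.ext (Fin.ext h1) (Fin.ext h))
      simp [Polynomial.coeff_monomial, h1, h2]
    · simp [Polynomial.coeff_monomial, h1]
  · simp

lemma natDegree_rectPoly_le {k l : ℕ} (f : Fin (k + 1) × Fin l → F) :
    (rectPoly (k + 1) l f).natDegree ≤ k := by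
  rw [rectPoly, Fintype.linearCombination_apply]
  refine natDegree_sum_le_of_forall_le _ _ fun x _ => ?_
  exact (natDegree_smul_le _ _).trans ((natDegree_monomial_le _).trans (by omega))

lemma natDegree_coeff_rectPoly_le {k l : ℕ} (f : Fin k × Fin (l + 1) → F) (i : ℕ) :
    ((rectPoly k (l + 1) f).coeff i).natDegree ≤ l := by
  rw [rectPoly, Fintype.linearCombination_apply, finsetSum_coeff]
  refine natDegree_sum_le_of_forall_le _ _ fun x _ => ?_
  rw [coeff_smul, Polynomial.coeff_monomial]
  refine (natDegree_smul_le _ _).trans ?_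
  split_ifs
  · exact (natDegree_monomial_le _).trans (by omega)
  · simp

lemma natDegree_coeff_mul_le {P S : F[X][X]} {h D : ℕ} (hP : ∀ i, (P.coeff i).natDegree ≤ h)
    (hS : ∀ i, (S.coeff i).natDegree ≤ D) (i : ℕ) : ((P * S).coeff i).natDegree ≤ h + D := by
  rw [coeff_mul]
  refine natDegree_sum_le_of_forall_le _ _ fun x _ => ?_
  exact natDegree_mul_le.trans (add_le_add (hP _) (hS _))

lemma natDegree_coeff_comp_map_C_le {Q : F[X][X]} {D : ℕ} (hQ : ∀ i, (Q.coeff i).natDegree ≤ D)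
    (R : F[X]) (i : ℕ) : ((Q.comp (R.map C)).coeff i).natDegree ≤ D := by
  rw [comp, eval₂_eq_sum_range, finsetSum_coeff]
  refine natDegree_sum_le_of_forall_le _ _ fun j _ => ?_
  rw [← Polynomial.map_pow, coeff_C_mul, coeff_map]
  exact (natDegree_mul_C_le _ _).trans (hQ j)

/-- Every nonzero `P` divides a nonzero polynomial in `R(X)` of degree at most `deg P` and
controlled height. -/
lemma exists_comp_eq_mul {P : F[X][X]} (hP0 : P ≠ 0) {h : ℕ}
    (hP : ∀ i, (P.coeff i).natDegree ≤ h) {R : F[X]} {a D : ℕ} (ha : 1 ≤ a)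
    (hR : R.natDegree ≤ a) (hD : (a * P.natDegree + 1) * h ≤ D) :
    ∃ Q S : F[X][X], Q ≠ 0 ∧ Q.natDegree ≤ P.natDegree ∧ (∀ i, (Q.coeff i).natDegree ≤ D) ∧
      (∀ i, (S.coeff i).natDegree ≤ D) ∧ Q.comp (R.map C) = P * S := by
  set d := P.natDegree
  have hda : d ≤ a * d := Nat.le_mul_of_pos_left d ha
  have hhD : h ≤ D := le_trans (Nat.le_mul_of_pos_left h (by omega)) hD
  obtain ⟨k, hk⟩ := Nat.exists_eq_add_of_le hda
  obtain ⟨E, hE⟩ := Nat.exists_eq_add_of_le hhD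
  let Φ : (Fin (d + 1) × Fin (D + 1) → F) × (Fin (k + 1) × Fin (E + 1) → F) →ₗ[F] F[X][X] :=
    LinearMap.coprod
      (((aeval (R.map C : F[X][X])).toLinearMap.restrictScalars F).comp (rectPoly (d + 1) (D + 1)))
      (-((LinearMap.mulLeft F P).comp (rectPoly (k + 1) (E + 1))))
  let Ψ : F[X][X] →ₗ[F] (Fin (a * d + 1) × Fin (D + 1) → F) :=
    { toFun := fun f x => (f.coeff x.1).coeff x.2
      map_add' := fun f g => by ext; simp
      map_smul' := fun c f => by ext; simp }
  have hlt : Module.finrank F (Fin (a * d + 1) × Fin (D + 1) → F) < Module.finrank F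
      ((Fin (d + 1) × Fin (D + 1) → F) × (Fin (k + 1) × Fin (E + 1) → F)) := by
    simp only [Module.finrank_prod, Module.finrank_fintype_fun_eq_card, Fintype.card_prod,
      Fintype.card_fin]
    rw [hk] at hD ⊢
    nlinarith
  obtain ⟨⟨f, g⟩, hker, hne⟩ :=
    (Submodule.ne_bot_iff _).1 (LinearMap.ker_ne_bot_of_finrank_lt (f := Ψ.comp Φ) hlt)
  set Q := rectPoly (d + 1) (D + 1) f with hQdef
  set S := rectPoly (k + 1) (E + 1) g with hSdef
  have hQd : Q.natDegree ≤ d := natDegree_rectPoly_le f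
  have hSd : S.natDegree ≤ k := natDegree_rectPoly_le g
  have hQD : ∀ i, (Q.coeff i).natDegree ≤ D := natDegree_coeff_rectPoly_le f
  have hSE : ∀ i, (S.coeff i).natDegree ≤ E := natDegree_coeff_rectPoly_le g
  have hΦ : Φ (f, g) = Q.comp (R.map C) - P * S := by
    simp [Φ, hQdef, hSdef, sub_eq_add_neg, comp, aeval_def]
  have hdeg : (Φ (f, g)).natDegree ≤ a * d := by
    rw [hΦ]
    refine (natDegree_sub_le _ _).trans (max_le ?_ ?_)
    · refine natDegree_comp_le.trans ?_
      rw [mul_comm]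
      exact Nat.mul_le_mul (natDegree_map_le.trans hR) hQd
    · exact natDegree_mul_le.trans (by omega)
  have hcoef : ∀ i, ((Φ (f, g)).coeff i).natDegree ≤ D := fun i => by
    rw [hΦ, coeff_sub]
    refine (natDegree_sub_le _ _).trans (max_le (natDegree_coeff_comp_map_C_le hQD R i) ?_)
    exact (natDegree_coeff_mul_le hP hSE i).trans hE.ge
  have hzero : Φ (f, g) = 0 := by
    ext i j
    by_cases hi : i < a * d + 1
    · by_cases hj : j < D + 1
      · exact congrFun (LinearMap.mem_ker.1 hker) (⟨i, hi⟩, ⟨j, hj⟩)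
      · simpa using coeff_eq_zero_of_natDegree_lt ((hcoef i).trans_lt (by omega))
    · simp [coeff_eq_zero_of_natDegree_lt (hdeg.trans_lt (by omega : a * d < i))]
  have heq : Q.comp (R.map C) = P * S := sub_eq_zero.1 (hΦ ▸ hzero)
  refine ⟨Q, S, fun hQ0 => hne ?_, hQd, hQD, fun i => (hSE i).trans (by omega), heq⟩
  have hS0 : S = 0 := by
    rw [hQ0, zero_comp] at heq
    exact (mul_eq_zero.1 heq.symm).resolve_left hP0
  refine Prod.ext (funext fun x => ?_) (funext fun x => ?_)
  · exact (coeff_coeff_rectPoly f x).symm.trans (by simp [← hQdef, hQ0])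
  · exact (coeff_coeff_rectPoly g x).symm.trans (by simp [← hSdef, hS0])

end AuxiliaryPolynomial

end OotoT

namespace OotoT

open HahnSeries

section RationalApproximation

variable {Fq : Type} [Field Fq]

/-- The truncation of a power series in `T⁻¹` after the term `T^{-e}`. -/
def truncSeries (z : PowerSeries Fq) (e : ℕ) : PowerSeries Fq :=
  ∑ k ∈ Finset.range (e + 1), PowerSeries.C (PowerSeries.coeff k z) * PowerSeries.X ^ k

/-- The numerator of `truncSeries z e` over the denominator `T^e`. -/
def truncNumerator (z : PowerSeries Fq) (e : ℕ) : Fq[X] :=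
  ∑ k ∈ Finset.range (e + 1), monomial (e - k) (PowerSeries.coeff k z)

lemma ringHomT_truncNumerator (z : PowerSeries Fq) (e : ℕ) :
    ringHomT Fq (truncNumerator z e)
      = ringHomT Fq (X ^ e) * ofPowerSeries ℤ Fq (truncSeries z e) := by
  rw [truncNumerator, truncSeries, map_sum, map_sum, Finset.mul_sum]
  refine Finset.sum_congr rfl fun k hk => ?_
  have hk' : k ≤ e := Nat.lt_succ_iff.1 (Finset.mem_range.1 hk)
  rw [map_mul, ofPowerSeries_X_pow, ofPowerSeries_C, ringHomT_monomial, ← monomial_one_right_eq_X_pow,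
    ringHomT_monomial, HahnSeries.C_apply, single_mul_single, single_mul_single]
  simp [Nat.cast_sub hk', sub_eq_neg_add]

lemma coeff_zero_truncNumerator (z : PowerSeries Fq) (e : ℕ) :
    (truncNumerator z e).coeff 0 = PowerSeries.coeff e z := by
  rw [truncNumerator, finsetSum_coeff, Finset.sum_eq_single e]
  · simp
  · intro k hk hne
    have := Finset.mem_range.1 hk
    exact Polynomial.coeff_monomial_of_ne _ (by omega)
  · simp

lemma coeff_truncSeries (z : PowerSeries Fq) (e k : ℕ) :
    PowerSeries.coeff k (truncSeries z e) = if k ≤ e then PowerSeries.coeff k z else 0 := by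
  simp [truncSeries, PowerSeries.coeff_X_pow]

lemma X_pow_dvd_sub_truncSeries {z : PowerSeries Fq} {e B : ℕ}
    (hgap : ∀ k, e < k → k < B → PowerSeries.coeff k z = 0) :
    PowerSeries.X ^ B ∣ z - truncSeries z e := by
  refine PowerSeries.X_pow_dvd_iff.2 fun k hk => ?_
  rw [map_sub, coeff_truncSeries]
  split_ifs with h
  · exact sub_self _
  · rw [hgap k (by omega) hk, sub_zero]

/-- A fraction with denominator exactly `T^e` is not a root of a polynomial of smaller height,
and the value there is bounded below in the usual way. -/
lemma addVal_evalP_truncSeries_le {z : PowerSeries Fq} {e D : ℕ} (he : PowerSeries.coeff e z ≠ 0)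
    {Q : Fq[X][X]} (hQ0 : Q ≠ 0) (hQ : ∀ i, (Q.coeff i).natDegree ≤ D) (hDe : D < e) :
    addVal ℤ Fq (evalP Fq (ofPowerSeries ℤ Fq (truncSeries z e)) Q)
      ≤ ((e * Q.natDegree : ℕ) : ℤ) := by
  set s : Fq[X] := X ^ e with hs
  set c := truncNumerator z e with hc
  set G := (Q.scaleRoots s).eval c with hG
  have hXc : ¬ X ∣ c := by
    rw [X_dvd_iff, hc, coeff_zero_truncNumerator]; exact he
  have hG0 : G ≠ 0 := by
    intro h0
    have hdvd := dvd_term_of_isRoot_of_dvd_terms (p := s) (f := Q.scaleRoots s) (r := c)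
      Q.natDegree h0 fun j hj => by
        rw [coeff_scaleRoots]
        rcases lt_or_gt_of_ne hj with hlt | hgt
        · exact ((dvd_pow_self s (by omega)).mul_left _).mul_right _
        · simp [coeff_eq_zero_of_natDegree_lt hgt]
    rw [coeff_scaleRoots_natDegree] at hdvd
    have hlc : s ∣ Q.leadingCoeff :=
      prime_X.pow_dvd_of_dvd_mul_right e (fun h => hXc (prime_X.dvd_of_dvd_pow h)) hdvd
    have hle := natDegree_le_of_dvd hlc (leadingCoeff_ne_zero.2 hQ0)
    rw [hs, natDegree_X_pow] at hle
    exact absurd (hQ Q.natDegree) (by rw [coeff_natDegree]; omega)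
  have hval : ringHomT Fq G = ringHomT Fq s ^ Q.natDegree *
      evalP Fq (ofPowerSeries ℤ Fq (truncSeries z e)) Q := by
    rw [evalP, ← scaleRoots_eval₂_mul, hs, ← ringHomT_truncNumerator, ← hc, hG, eval₂_at_apply]
  have hle := addVal_ringHomT_le_zero hG0
  rw [hval, ← map_pow, AddValuation.map_mul] at hle
  have hspow : addVal ℤ Fq (ringHomT Fq (s ^ Q.natDegree)) = ((-(e * Q.natDegree : ℕ) : ℤ)) := by
    rw [hs, ← pow_mul, ← monomial_one_right_eq_X_pow, ringHomT_monomial, addVal_apply,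
      orderTop_single one_ne_zero]
  rw [hspow] at hle
  generalize addVal ℤ Fq (evalP Fq (ofPowerSeries ℤ Fq (truncSeries z e)) Q) = t at hle ⊢
  induction t with
  | top => simp at hle
  | coe t =>
    have hle' : (-(e * Q.natDegree : ℕ) : ℤ) + t ≤ 0 := by exact_mod_cast hle
    exact_mod_cast (by omega : t ≤ ((e * Q.natDegree : ℕ) : ℤ))

lemma addVal_evalP_le {z : PowerSeries Fq} {e B D n : ℕ} (he : PowerSeries.coeff e z ≠ 0)
    (hgap : ∀ k, e < k → k < B → PowerSeries.coeff k z = 0)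
    {Q : Fq[X][X]} (hQ0 : Q ≠ 0) (hQn : Q.natDegree ≤ n) (hQ : ∀ i, (Q.coeff i).natDegree ≤ D)
    (hDe : D < e) (hB : e * n + D < B) :
    addVal ℤ Fq (evalP Fq (ofPowerSeries ℤ Fq z) Q) ≤ ((e * n : ℕ) : ℤ) := by
  by_contra! hlt
  have htrunc : addVal ℤ Fq (evalP Fq (ofPowerSeries ℤ Fq (truncSeries z e)) Q)
      ≤ ((e * n : ℕ) : ℤ) :=
    (addVal_evalP_truncSeries_le he hQ0 hQ hDe).trans
      (by exact_mod_cast Nat.mul_le_mul_left e hQn)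
  have hdiff : (((e * n : ℕ) : ℤ) : WithTop ℤ) < addVal ℤ Fq
      (evalP Fq (ofPowerSeries ℤ Fq z) Q -
        evalP Fq (ofPowerSeries ℤ Fq (truncSeries z e)) Q) :=
    lt_of_lt_of_le (by exact_mod_cast (by push_cast; zify at hB; linarith :
        ((e * n : ℕ) : ℤ) < (B : ℤ) - D))
      (le_addVal_evalP_sub hQ (X_pow_dvd_sub_truncSeries hgap))
  have hmin := lt_of_lt_of_le (lt_min hlt hdiff) (AddValuation.map_sub _ _ _)
  rw [sub_sub_cancel] at hmin
  exact absurd hmin (not_lt.2 htrunc)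

/-- A lower bound for `|P(ξ)|` from a rational approximation to `ξ - ξ^a`. -/
lemma addVal_evalP_le_of_gap {x : PowerSeries Fq} {a e B D n h : ℕ} (ha : 1 ≤ a)
    (he : PowerSeries.coeff e (x - x ^ a) ≠ 0)
    (hgap : ∀ k, e < k → k < B → PowerSeries.coeff k (x - x ^ a) = 0)
    {P : Fq[X][X]} (hP0 : P ≠ 0) (hPn : P.natDegree ≤ n) (hP : ∀ i, (P.coeff i).natDegree ≤ h)
    (hD : (a * n + 1) * h ≤ D) (hDe : D < e) (hB : e * n + D < B) :
    addVal ℤ Fq (evalP Fq (ofPowerSeries ℤ Fq x) P) ≤ ((e * n + D : ℕ) : ℤ) := by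
  have hR : (X - X ^ a : Fq[X]).natDegree ≤ a := by
    refine (natDegree_sub_le _ _).trans (max_le ?_ ?_) <;> simp [ha]
  obtain ⟨Q, S, hQ0, hQd, hQD, hSD, heq⟩ := exists_comp_eq_mul hP0 hP ha hR (D := D)
    (le_trans (by gcongr) hD)
  have hQ := addVal_evalP_le he hgap hQ0 (hQd.trans hPn) hQD hDe hB
  have hcomp : evalP Fq (ofPowerSeries ℤ Fq (x - x ^ a)) Q =
      evalP Fq (ofPowerSeries ℤ Fq x) P * evalP Fq (ofPowerSeries ℤ Fq x) S := by
    rw [evalP, evalP, evalP, ← eval₂_mul, ← heq, eval₂_comp]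
    simp
  rw [hcomp, AddValuation.map_mul] at hQ
  have hS := neg_le_addVal_evalP hSD x
  generalize addVal ℤ Fq (evalP Fq (ofPowerSeries ℤ Fq x) P) = t at hQ ⊢
  generalize addVal ℤ Fq (evalP Fq (ofPowerSeries ℤ Fq x) S) = u at hQ hS
  induction t with
  | top => exact absurd (top_le_iff.1 (by rwa [top_add] at hQ)) WithTop.coe_ne_top
  | coe t =>
    induction u with
    | top => exact absurd (top_le_iff.1 (by rwa [add_top] at hQ)) WithTop.coe_ne_top
    | coe u =>
      have h1 : t + u ≤ ((e * n : ℕ) : ℤ) := by exact_mod_cast hQ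
      have h2 : -(D : ℤ) ≤ u := by exact_mod_cast hS
      refine WithTop.coe_le_coe.2 ?_
      push_cast at h1 ⊢
      linarith

end RationalApproximation

end OotoT

namespace OotoT

open HahnSeries

section GapStructure

/-- The exponents `m_0 m_1 ⋯ m_j`. -/
def mprod (m : ℕ → ℕ) (j : ℕ) : ℕ := ∏ i ∈ Finset.range (j + 1), m i

variable {m : ℕ → ℕ}

lemma mprod_succ (m : ℕ → ℕ) (j : ℕ) : mprod m (j + 1) = mprod m j * m (j + 1) :=
  Finset.prod_range_succ _ _

lemma mprod_dvd_mprod (m : ℕ → ℕ) {i j : ℕ} (hij : i ≤ j) : mprod m i ∣ mprod m j :=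
  Finset.prod_dvd_prod_of_subset _ _ _ (Finset.range_mono (by omega))

lemma rr_eq (r : ℕ) (m : ℕ → ℕ) (j : ℕ) : rr r m j = r ^ mprod m j := rfl

lemma lt_mprod (hm0 : m 0 = 1) (hm : ∀ j : ℕ, 1 ≤ j → 2 ≤ m j) (j : ℕ) : j < mprod m j := by
  induction j with
  | zero => simp [mprod, hm0]
  | succ j ih =>
    rw [mprod_succ]
    nlinarith [hm (j + 1) (by omega)]

/-- The power series in `T⁻¹` underlying `ξ(r, m)`. -/
def xiSeries (Fq : Type) [Field Fq] (r : ℕ) (m : ℕ → ℕ) : PowerSeries Fq :=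
  PowerSeries.mk fun k =>
    ∑ᶠ j : ℕ, ((1 : ℕ) : Fq) * (if ∃ n : ℕ, 1 ≤ n ∧ k = rr r m j ^ n then 1 else 0)

variable {Fq : Type} [Field Fq] {r : ℕ}

lemma xi_eq_ofPowerSeries : xi Fq r m = ofPowerSeries ℤ Fq (xiSeries Fq r m) := rfl

lemma coeff_xiSeries (K : ℕ) : PowerSeries.coeff K (xiSeries Fq r m) =
    ∑ᶠ j : ℕ, (if ∃ n : ℕ, 1 ≤ n ∧ K = rr r m j ^ n then (1 : Fq) else 0) := by
  simp [xiSeries]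

lemma coeff_xiSeries_eq_zero {K : ℕ} (hK : ∀ k, K ≠ r ^ k) :
    PowerSeries.coeff K (xiSeries Fq r m) = 0 := by
  rw [coeff_xiSeries]
  refine finsum_eq_zero_of_forall_eq_zero fun j => if_neg ?_
  rintro ⟨n, -, rfl⟩
  exact hK _ (by rw [rr_eq, ← pow_mul])

lemma coeff_xiSeries_pow (hr : 2 ≤ r) (hm0 : m 0 = 1) (hm : ∀ j : ℕ, 1 ≤ j → 2 ≤ m j)
    {k L : ℕ} (hk : 1 ≤ k) (hkL : k ≤ L) : PowerSeries.coeff (r ^ k) (xiSeries Fq r m) =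
      ∑ j ∈ Finset.range L, if mprod m j ∣ k then (1 : Fq) else 0 := by
  have hiff : ∀ j, (∃ n : ℕ, 1 ≤ n ∧ r ^ k = rr r m j ^ n) ↔ mprod m j ∣ k := fun j => by
    constructor
    · rintro ⟨n, -, h⟩
      rw [rr_eq, ← pow_mul] at h
      exact ⟨n, Nat.pow_right_injective hr h⟩
    · rintro ⟨n, rfl⟩
      exact ⟨n, Nat.pos_of_mul_pos_left hk, by rw [rr_eq, ← pow_mul]⟩
  simp only [coeff_xiSeries, hiff]
  refine finsum_eq_sum_of_support_subset _ fun j hj => ?_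
  have hdvd : mprod m j ∣ k := by
    by_contra h
    exact hj (if_neg h)
  have := lt_mprod hm0 hm j
  have := Nat.le_of_dvd hk hdvd
  simp only [Finset.coe_range, Set.mem_Iio]
  omega

lemma coeff_xiSeries_pow_char {p : ℕ} [Fact p.Prime] [CharP Fq p] (s K : ℕ) :
    PowerSeries.coeff K (xiSeries Fq r m ^ p ^ s) =
      if p ^ s ∣ K then PowerSeries.coeff (K / p ^ s) (xiSeries Fq r m) else 0 := by
  have hp : p ≠ 0 := (Fact.out : p.Prime).ne_zero
  have hmap : PowerSeries.map (iterateFrobenius Fq p s) (xiSeries Fq r m) = xiSeries Fq r m := by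
    ext K
    rw [PowerSeries.coeff_map, coeff_xiSeries]
    refine finsum_induction (fun c => iterateFrobenius Fq p s c = c) (map_zero _)
      (fun x y hx hy => by rw [map_add, hx, hy]) fun j => ?_
    split_ifs <;> simp
  have hexp : PowerSeries.expand (p ^ s) (pow_ne_zero s hp) (xiSeries Fq r m) =
      xiSeries Fq r m ^ p ^ s := by
    conv_lhs => rw [← hmap]
    rw [← PowerSeries.map_expand]
    exact MvPowerSeries.map_iterateFrobenius_expand p hp _ s
  rw [← hexp, PowerSeries.coeff_expand]

lemma coeff_xiSeries_sub_pow {p : ℕ} [Fact p.Prime] [CharP Fq p] {f : ℕ} (hf : 0 < f)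
    (hr : r = p ^ f) (hm0 : m 0 = 1) (hm : ∀ j : ℕ, 1 ≤ j → 2 ≤ m j) {J k L : ℕ}
    (hk : mprod m J < k) (hkL : k ≤ L) :
    PowerSeries.coeff (r ^ k) (xiSeries Fq r m - xiSeries Fq r m ^ rr r m J) =
      ∑ j ∈ Finset.range L, ((if mprod m j ∣ k then (1 : Fq) else 0) -
        (if mprod m j ∣ k - mprod m J then 1 else 0)) := by
  have hp2 : 2 ≤ p := (Fact.out : p.Prime).two_le
  have hr2 : 2 ≤ r := hr ▸ hp2.trans (Nat.le_self_pow hf.ne' p)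
  have ha : rr r m J = p ^ (f * mprod m J) := by rw [rr_eq, hr, ← pow_mul]
  have hsplit : r ^ k = rr r m J * r ^ (k - mprod m J) := by
    rw [rr_eq, ← _root_.pow_add]; congr 1; omega
  have hpos : 0 < rr r m J := by rw [rr_eq]; positivity
  rw [map_sub, ha, coeff_xiSeries_pow_char, ← ha, if_pos ⟨_, hsplit⟩, hsplit,
    Nat.mul_div_cancel_left _ hpos, ← hsplit, coeff_xiSeries_pow hr2 hm0 hm (by omega) hkL,
    coeff_xiSeries_pow hr2 hm0 hm (by omega) ((Nat.sub_le _ _).trans hkL),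
    Finset.sum_sub_distrib]

lemma ite_dvd_sub_ite_dvd_eq_zero {J j k : ℕ} (hj : j ≤ J) (hk : mprod m J ≤ k) :
    ((if mprod m j ∣ k then (1 : Fq) else 0) -
      (if mprod m j ∣ k - mprod m J then 1 else 0)) = 0 := by
  have : mprod m j ∣ k - mprod m J ↔ mprod m j ∣ k :=
    (Nat.dvd_sub_iff_left hk (mprod_dvd_mprod m hj))
  simp [this]

lemma not_dvd_of_between {a N k : ℕ} (h1 : N * a < k) (h2 : k < (N + 1) * a) : ¬ a ∣ k := by
  rintro ⟨c, rfl⟩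
  rw [mul_comm a c] at h1 h2
  have := lt_of_mul_lt_mul_right h1 (Nat.zero_le a)
  have := lt_of_mul_lt_mul_right h2 (Nat.zero_le a)
  omega

/-- The gaps in the expansion of `ξ - ξ^{r_J}`. -/
lemma coeff_xiSeries_sub_pow_eq_zero {p : ℕ} [Fact p.Prime] [CharP Fq p] {f : ℕ} (hf : 0 < f)
    (hr : r = p ^ f) (hm0 : m 0 = 1) (hm : ∀ j : ℕ, 1 ≤ j → 2 ≤ m j) {J N K : ℕ}
    (h1 : rr r m J * rr r m (J + 1) ^ N < K) (h2 : K < rr r m (J + 1) ^ (N + 1)) :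
    PowerSeries.coeff K (xiSeries Fq r m - xiSeries Fq r m ^ rr r m J) = 0 := by
  have hp2 : 2 ≤ p := (Fact.out : p.Prime).two_le
  have hr2 : 2 ≤ r := hr ▸ hp2.trans (Nat.le_self_pow hf.ne' p)
  by_cases hK : ∃ k, K = r ^ k
  · obtain ⟨k, rfl⟩ := hK
    rw [rr_eq, rr_eq, ← pow_mul, ← _root_.pow_add, Nat.pow_lt_pow_iff_right hr2] at h1
    rw [rr_eq, ← pow_mul, Nat.pow_lt_pow_iff_right hr2] at h2
    rw [mul_comm _ N] at h1
    rw [mul_comm _ (N + 1)] at h2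
    rw [coeff_xiSeries_sub_pow hf hr hm0 hm (by omega) le_rfl]
    refine Finset.sum_eq_zero fun j _ => ?_
    rcases le_or_gt j J with hj | hj
    · exact ite_dvd_sub_ite_dvd_eq_zero hj (by omega)
    · have hdvd : mprod m (J + 1) ∣ mprod m j := mprod_dvd_mprod m hj
      have hn1 : ¬ mprod m j ∣ k := fun h =>
        not_dvd_of_between (N := N) (by omega) (by omega) (hdvd.trans h)
      have hn2 : ¬ mprod m j ∣ k - mprod m J := fun h =>
        not_dvd_of_between (N := N) (by omega) (by omega) (hdvd.trans h)
      simp [hn1, hn2]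
  · have ha : rr r m J = p ^ (f * mprod m J) := by rw [rr_eq, hr, ← pow_mul]
    rw [map_sub, coeff_xiSeries_eq_zero fun k h => hK ⟨k, h⟩, ha, coeff_xiSeries_pow_char, ← ha,
      zero_sub, neg_eq_zero]
    split_ifs with hd
    · obtain ⟨c, rfl⟩ := hd
      have hpos : 0 < rr r m J := by rw [rr_eq]; positivity
      rw [Nat.mul_div_cancel_left _ hpos]
      refine coeff_xiSeries_eq_zero fun k h => hK ⟨mprod m J + k, ?_⟩
      rw [h, rr_eq, _root_.pow_add]
    · rfl

/-- The coefficient of `ξ - ξ^{r_J}` just before a gap. -/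
lemma coeff_xiSeries_sub_pow_ne_zero {p : ℕ} [Fact p.Prime] [CharP Fq p] {f : ℕ} (hf : 0 < f)
    (hr : r = p ^ f) (hm0 : m 0 = 1) (hm : ∀ j : ℕ, 1 ≤ j → 2 ≤ m j) {J N : ℕ}
    (hN : ¬ m (J + 2) ∣ N) :
    PowerSeries.coeff (rr r m J * rr r m (J + 1) ^ N)
      (xiSeries Fq r m - xiSeries Fq r m ^ rr r m J) ≠ 0 := by
  have hN0 : 0 < N := Nat.pos_of_ne_zero fun h => hN (h ▸ dvd_zero _)
  have hJpos : 0 < mprod m J := (Nat.zero_le _).trans_lt (lt_mprod hm0 hm J)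
  have hlt : mprod m J < mprod m (J + 1) := by
    rw [mprod_succ]; nlinarith [hm (J + 1) (by omega)]
  have hNpos : 0 < N * mprod m (J + 1) := Nat.mul_pos hN0 (hJpos.trans hlt)
  have hexp : rr r m J * rr r m (J + 1) ^ N = r ^ (mprod m J + N * mprod m (J + 1)) := by
    rw [rr_eq, rr_eq, ← pow_mul, ← _root_.pow_add, mul_comm N]
  have hnd : ¬ mprod m (J + 1) ∣ mprod m J + N * mprod m (J + 1) :=
    not_dvd_of_between (N := N) (by omega) (by rw [add_mul]; omega)
  rw [hexp, coeff_xiSeries_sub_pow hf hr hm0 hm (L := mprod m J + N * mprod m (J + 1) + (J + 2))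
    (by omega) (by omega), Finset.sum_eq_single (J + 1)]
  · simp [hnd]
  · intro j _ hj
    rcases le_or_gt j J with hjJ | hjJ
    · exact ite_dvd_sub_ite_dvd_eq_zero hjJ (by omega)
    · have hn1 : ¬ mprod m j ∣ mprod m J + N * mprod m (J + 1) := fun h =>
        hnd ((mprod_dvd_mprod m hjJ).trans h)
      have hn2 : ¬ mprod m j ∣ N * mprod m (J + 1) := fun h => by
        have h' := (mprod_dvd_mprod m (by omega : J + 2 ≤ j)).trans h
        rw [mprod_succ m (J + 1), mul_comm] at h'
        exact hN (Nat.dvd_of_mul_dvd_mul_right (hJpos.trans hlt) h')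
      simp [hn1, hn2]
  · intro h
    exact absurd (Finset.mem_range.2 (by omega)) h

end GapStructure

end OotoT

namespace OotoT

open HahnSeries

section Exponents

variable {Fq : Type} [Field Fq]

/-- The logarithm to base `q` of the height of a nonzero polynomial. -/
def logHeight (P : Fq[X][X]) : ℕ := P.support.sup fun i => (P.coeff i).natDegree

lemma natDegree_coeff_le_logHeight (P : Fq[X][X]) (i : ℕ) :
    (P.coeff i).natDegree ≤ logHeight P := by
  by_cases hi : i ∈ P.support
  · exact Finset.le_sup (f := fun i => (P.coeff i).natDegree) hi
  · simp [notMem_support_iff.1 hi]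

lemma finite_logHeight_eq_zero [Finite Fq] (n : ℕ) :
    {P : Fq[X][X] | P.natDegree ≤ n ∧ logHeight P = 0}.Finite := by
  refine Set.Finite.of_finite_image (f := fun P (i : Fin (n + 1)) => (P.coeff i).coeff 0)
    (Set.toFinite _) ?_
  rintro P ⟨hPn, hP⟩ Q ⟨hQn, hQ⟩ h
  have hconst : ∀ {R : Fq[X][X]}, logHeight R = 0 → ∀ i, R.coeff i = C ((R.coeff i).coeff 0) :=
    fun hR i => eq_C_of_natDegree_le_zero (hR ▸ natDegree_coeff_le_logHeight _ i)
  refine Polynomial.ext fun i => ?_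
  by_cases hi : i < n + 1
  · rw [hconst hP, hconst hQ]
    exact congrArg Polynomial.C (congrFun h ⟨i, hi⟩)
  · rw [coeff_eq_zero_of_natDegree_lt (by omega), coeff_eq_zero_of_natDegree_lt (by omega)]

lemma exists_pow_not_dvd {b y c : ℕ} (hb : 2 ≤ b) (hy : 1 ≤ y) (hc : 2 ≤ c) :
    ∃ N, ¬ c ∣ N ∧ y < b ^ N ∧ b ^ N ≤ b ^ 2 * y := by
  have hlt := Nat.lt_pow_succ_log_self hb y
  have hle := Nat.pow_log_le_self b (by omega : y ≠ 0)
  set l := Nat.log b y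
  by_cases hcl : c ∣ l + 1
  · refine ⟨l + 2, fun h => ?_, hlt.trans_le (Nat.pow_le_pow_right (by omega) (by omega)), ?_⟩
    · have h1 := (Nat.dvd_add_right hcl).1 (show c ∣ l + 1 + 1 from h)
      have := Nat.le_of_dvd one_pos h1
      omega
    · calc b ^ (l + 2) = b ^ 2 * b ^ l := by ring
        _ ≤ b ^ 2 * y := by gcongr
  · refine ⟨l + 1, hcl, hlt, ?_⟩
    calc b ^ (l + 1) = b ^ 1 * b ^ l := by ring
      _ ≤ b ^ 2 * y := by gcongr <;> omega

variable {p f r : ℕ} {m : ℕ → ℕ}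

/-- A transcendence measure for `ξ(r, m)` in degree less than `r_J`. -/
lemma order_evalP_xi_le [Fact p.Prime] [CharP Fq p] (hf : 0 < f) (hr : r = p ^ f) (hm0 : m 0 = 1)
    (hm : ∀ j : ℕ, 1 ≤ j → 2 ≤ m j) {n J : ℕ} (hnJ : n < rr r m J) {P : Fq[X][X]}
    (hPn : P.natDegree ≤ n) (hP : evalP Fq (xi Fq r m) P ≠ 0) (hh : 1 ≤ logHeight P) :
    (evalP Fq (xi Fq r m) P).order
      ≤ ((rr r m J * rr r m (J + 1) ^ 2 * (n + 1) ^ 2 * logHeight P : ℕ) : ℤ) := by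
  set h := logHeight P
  set a := rr r m J with ha
  set b := rr r m (J + 1) with hb
  have ha1 : 1 ≤ a := by omega
  have hab : a ^ 2 ≤ b := by
    rw [ha, hb, rr_eq, rr_eq, mprod_succ, pow_mul]
    exact Nat.pow_le_pow_right ha1 (hm (J + 1) (by omega))
  have hb2 : 2 ≤ b := by
    have hp2 : 2 ≤ p := (Fact.out : p.Prime).two_le
    have hr2 : 2 ≤ r := hr ▸ hp2.trans (Nat.le_self_pow hf.ne' p)
    rw [hb, rr_eq]
    exact hr2.trans (Nat.le_self_pow
      ((Nat.zero_le _).trans_lt (lt_mprod hm0 hm (J + 1))).ne' r)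
  obtain ⟨N, hN, hyN, hNy⟩ := exists_pow_not_dvd hb2
    (Nat.mul_pos (Nat.succ_pos n) hh) (hm (J + 2) (by omega))
  have hDe : (a * n + 1) * h < a * b ^ N := by
    calc (a * n + 1) * h ≤ (a * n + a) * h := by gcongr
      _ = a * ((n + 1) * h) := by ring
      _ < a * b ^ N := Nat.mul_lt_mul_of_pos_left hyN ha1
  have hB : a * b ^ N * n + (a * n + 1) * h < b ^ (N + 1) := by
    calc a * b ^ N * n + (a * n + 1) * h < a * b ^ N * n + a * b ^ N := by omega
      _ = a * (n + 1) * b ^ N := by ring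
      _ ≤ a * a * b ^ N := by gcongr; omega
      _ ≤ b * b ^ N := by gcongr; rwa [← sq]
      _ = b ^ (N + 1) := by ring
  have hP0 : P ≠ 0 := by rintro rfl; exact hP (by simp [evalP])
  have hval := addVal_evalP_le_of_gap ha1
    (coeff_xiSeries_sub_pow_ne_zero (Fq := Fq) hf hr hm0 hm hN)
    (fun k h1 h2 => coeff_xiSeries_sub_pow_eq_zero hf hr hm0 hm h1 h2) hP0 hPn
    (natDegree_coeff_le_logHeight P) le_rfl hDe hB
  rw [← xi_eq_ofPowerSeries, addVal_apply_of_ne hP] at hval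
  refine (WithTop.coe_le_coe.1 hval).trans ?_
  norm_cast
  calc a * b ^ N * n + (a * n + 1) * h ≤ a * b ^ N * n + a * b ^ N := by omega
    _ = a * b ^ N * (n + 1) := by ring
    _ ≤ a * (b ^ 2 * ((n + 1) * h)) * (n + 1) := by gcongr
    _ = a * b ^ 2 * (n + 1) ^ 2 * h := by ring

lemma wn_xi_le [Finite Fq] [Fact p.Prime] [CharP Fq p] (hf : 0 < f) (hr : r = p ^ f)
    (hm0 : m 0 = 1) (hm : ∀ j : ℕ, 1 ≤ j → 2 ≤ m j) {q : ℕ} (hq : 2 ≤ q) {n J : ℕ}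
    (hnJ : n < rr r m J) :
    wn Fq q n (xi Fq r m)
      ≤ (((rr r m J * rr r m (J + 1) ^ 2 * (n + 1) ^ 2 : ℕ) : ℝ) : EReal) := by
  refine sSup_le ?_
  rintro _ ⟨w, hw, rfl⟩
  obtain ⟨P, ⟨hPn, hpos, hle⟩, hPh⟩ := (hw.sdiff (finite_logHeight_eq_zero n)).nonempty
  have hh : 1 ≤ logHeight P := Nat.pos_of_ne_zero fun h => hPh ⟨hPn, h⟩
  have hval0 : evalP Fq (xi Fq r m) P ≠ 0 := by
    intro h0
    simp [absL, h0] at hpos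
  have hP0 : P ≠ 0 := by rintro rfl; exact hval0 (by simp [evalP])
  have hord := order_evalP_xi_le hf hr hm0 hm hnJ hPn hval0 hh
  have hq1 : (1 : ℝ) < q := by exact_mod_cast hq
  rw [absL, if_neg hval0, heightP, if_neg hP0, ← Real.rpow_natCast, ← Real.rpow_intCast,
    ← Real.rpow_mul (by positivity), Real.rpow_le_rpow_left_iff hq1] at hle
  refine EReal.coe_le_coe_iff.2 ?_
  have hh' : (1 : ℝ) ≤ logHeight P := by exact_mod_cast hh
  have hord' : ((evalP Fq (xi Fq r m) P).order : ℝ) ≤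
      ((rr r m J * rr r m (J + 1) ^ 2 * (n + 1) ^ 2 : ℕ) : ℝ) * logHeight P := by
    exact_mod_cast hord
  change ((-(evalP Fq (xi Fq r m) P).order : ℤ) : ℝ) ≤ (logHeight P : ℝ) * -w at hle
  push_cast at hle hord' ⊢
  refine le_of_mul_le_mul_right ?_ (zero_lt_one.trans_le hh')
  linarith

lemma neg_one_le_wn {q : ℕ} (hq : 2 ≤ q) (n : ℕ) (ξ : LaurentSeries Fq) :
    ((-1 : ℝ) : EReal) ≤ wn Fq q n ξ := by
  refine le_sSup ⟨-1, ?_, rfl⟩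
  refine Set.infinite_of_injective_forall_mem (f := fun k : ℕ => (C (X ^ k) : Fq[X][X])) ?_ ?_
  · intro k l hkl
    simpa using congrArg natDegree (C_injective hkl)
  · intro k
    have heval : evalP Fq ξ (C (X ^ k)) = single (-(k : ℤ)) 1 := by
      rw [evalP, eval₂_C, ← monomial_one_right_eq_X_pow, ringHomT_monomial]
    have hne : (single (-(k : ℤ)) (1 : Fq)) ≠ 0 := single_ne_zero one_ne_zero
    have hC : (C (X ^ k) : Fq[X][X]) ≠ 0 := by simp
    have habs : absL Fq q (evalP Fq ξ (C (X ^ k))) = (q : ℝ) ^ k := by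
      rw [heval, absL, if_neg hne, order_single one_ne_zero, neg_neg, zpow_natCast]
    have hheight : heightP Fq q (C (X ^ k) : Fq[X][X]) = (q : ℝ) ^ k := by
      rw [heightP, if_neg hC, support_C (by simp), Finset.sup_singleton, coeff_C_zero, natDegree_X_pow]
    have hq0 : (0 : ℝ) < q := by exact_mod_cast (by omega : 0 < q)
    refine ⟨by simp, ?_, ?_⟩
    · rw [habs]; positivity
    · rw [habs, hheight, neg_neg, Real.rpow_one]

lemma log_toReal_le_log {x : EReal} {c : ℝ} (hc : 1 ≤ c) (h1 : ((-1 : ℝ) : EReal) ≤ x)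
    (h2 : x ≤ (c : EReal)) : Real.log x.toReal ≤ Real.log c := by
  induction x with
  | bot => exact absurd (le_bot_iff.1 h1) (EReal.coe_ne_bot _)
  | top => exact absurd (top_le_iff.1 h2) (EReal.coe_ne_top _)
  | coe x =>
    rw [EReal.coe_le_coe_iff] at h1 h2
    rw [EReal.toReal_coe]
    rcases eq_or_ne x 0 with rfl | hx
    · simpa using Real.log_nonneg hc
    · rw [← Real.log_abs x]
      exact Real.log_le_log (abs_pos.2 hx) (abs_le.2 ⟨by linarith, h2⟩)

lemma rr_mono (hr : 1 ≤ r) (hm0 : m 0 = 1) (hm : ∀ j : ℕ, 1 ≤ j → 2 ≤ m j) :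
    Monotone (rr r m) := fun _ j hij =>
  Nat.pow_le_pow_right hr (Nat.le_of_dvd ((Nat.zero_le _).trans_lt (lt_mprod hm0 hm j))
    (mprod_dvd_mprod m hij))

lemma lt_rr (hr : 2 ≤ r) (hm0 : m 0 = 1) (hm : ∀ j : ℕ, 1 ≤ j → 2 ≤ m j) (j : ℕ) :
    j < rr r m j :=
  (lt_mprod hm0 hm j).trans (Nat.lt_pow_self hr)

lemma rr_succ (j : ℕ) : rr r m (j + 1) = rr r m j ^ m (j + 1) := by
  rw [rr_eq, rr_eq, mprod_succ, pow_mul]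

lemma rr_mul_rr_sq_le {n J : ℕ} (hn : 3 ≤ n) (hJ : rr r m J ≤ n) (hm : 3 ≤ m (J + 1)) :
    rr r m (J + 1) * rr r m (J + 2) ^ 2 * (n + 1) ^ 2
      ≤ n ^ (2 * m (J + 1) + 2 * m (J + 1) * m (J + 2)) := by
  have h1 : rr r m (J + 1) ≤ n ^ m (J + 1) := by
    rw [rr_succ]; exact Nat.pow_le_pow_left hJ _
  have h2 : rr r m (J + 2) ≤ n ^ (m (J + 1) * m (J + 2)) := by
    rw [rr_succ, pow_mul]; exact Nat.pow_le_pow_left h1 _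
  have h3 : (n + 1) ^ 2 ≤ n ^ 3 := by nlinarith [sq_nonneg n]
  calc rr r m (J + 1) * rr r m (J + 2) ^ 2 * (n + 1) ^ 2
      ≤ n ^ m (J + 1) * (n ^ (m (J + 1) * m (J + 2))) ^ 2 * n ^ 3 := by gcongr
    _ = n ^ (m (J + 1) + 2 * m (J + 1) * m (J + 2) + 3) := by ring
    _ ≤ _ := Nat.pow_le_pow_right (by omega) (by omega)

end Exponents

end OotoT

/-- If moreover `m_j ≥ 3` for all sufficiently large `j`, then
`t(ξ(r,m)) ≤ limsup_j (2 m_j + 2 m_j m_{j+1})`. -/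
theorem type_upper_bound (p : ℕ) (hp : p.Prime) (q : ℕ) (hq : ∃ e : ℕ, 0 < e ∧ q = p ^ e)
    (Fq : Type) [Field Fq] [Fintype Fq] [CharP Fq p] (hcard : Fintype.card Fq = q)
    (r : ℕ) (hr : ∃ e : ℕ, 0 < e ∧ r = p ^ e)
    (m : ℕ → ℕ) (hm0 : m 0 = 1) (hm : ∀ j : ℕ, 1 ≤ j → 2 ≤ m j)
    (hm3 : ∀ᶠ j in Filter.atTop, 3 ≤ m j) :
    typeT Fq q (xi Fq r m)
      ≤ Filter.limsup (fun j : ℕ =>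
          ((2 * (m j : ℝ) + 2 * (m j : ℝ) * (m (j + 1) : ℝ) : ℝ) : EReal)) Filter.atTop := by
  obtain ⟨e, he, rfl⟩ := hq
  obtain ⟨f, hf, hrf⟩ := hr
  have : Fact p.Prime := ⟨hp⟩
  have hq2 : 2 ≤ p ^ e := hp.two_le.trans (Nat.le_self_pow he.ne' p)
  have hr2 : 2 ≤ r := hrf ▸ hp.two_le.trans (Nat.le_self_pow hf.ne' p)
  have hex : ∀ n, ∃ j, n < rr r m j := fun n => ⟨n, lt_rr hr2 hm0 hm n⟩
  let J : ℕ → ℕ := fun n => Nat.find (hex n)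
  have hJ : Tendsto J atTop atTop := by
    refine tendsto_atTop.2 fun j => ?_
    filter_upwards [eventually_ge_atTop (rr r m j)] with n hn
    by_contra! hlt
    have h1 : n < rr r m (J n) := Nat.find_spec (hex n)
    have h2 : rr r m (J n) ≤ rr r m j := rr_mono (by omega) hm0 hm hlt.le
    omega
  refine le_trans (limsup_le_limsup ?_) hJ.limsup_comp_le_limsup
  filter_upwards [eventually_ge_atTop 3, hJ.eventually hm3, hJ.eventually_ge_atTop 1]
    with n hn hm3n hJ1
  have hspec : n < rr r m (J n) := Nat.find_spec (hex n)
  obtain ⟨k, hk⟩ := Nat.exists_eq_add_of_le' hJ1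
  have hmin : rr r m k ≤ n := not_lt.1 (Nat.find_min (hex n) (show k < J n by omega))
  simp only [Function.comp_apply]
  rw [hk] at hspec hm3n ⊢
  have hpow := rr_mul_rr_sq_le hn hmin hm3n
  have hle := (wn_xi_le (Fq := Fq) hf hrf hm0 hm hq2 hspec).trans
    (EReal.coe_le_coe_iff.2 (Nat.cast_le.2 hpow))
  have hn1 : (1 : ℝ) < n := by exact_mod_cast (by omega : 1 < n)
  have hlog := log_toReal_le_log (by exact_mod_cast Nat.one_le_pow _ _ (by omega))
    (neg_one_le_wn hq2 n _) hle
  rw [EReal.coe_le_coe_iff, div_le_iff₀ (Real.log_pos hn1)]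
  refine hlog.trans_eq ?_
  rw [Nat.cast_pow, Real.log_pow]
  push_cast
  ring
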